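/- Let G be a finitely generated group and H ◁ G a normal subgroup with G/H isomorphic to ℤ. Fix a finite generating set of G and let |·| denote the associated word length. Let m be a symmetric, finitely supported probability measure on G whose support generates G as a group. Let τ((g_n)) := inf{n ≥ 1 : g₁⋯g_n ∈ H} (which is finite m^ℕ-a.e.), define ξ((g_n)) = g₁⋯g_{τ((g_n))} ∈ H, and let m' := ξ_* m^ℕ be the induced first-return probability measure on H. Then for every real p with 0 ≤ p < 1/2, m' has finite p-th moment: Σ_{h∈H} |h|^p·m'(h) < +∞. -/

import Mathlib

open MeasureTheory
open scoped ENNReal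

/-- The word length of `g` with respect to the generating set `S`: the least `n`
such that `g` is a product of `n` elements of `S ∪ S⁻¹`. -/
noncomputable def wordLength {G : Type*} [Group G] (S : Finset G) (g : G) : ℕ :=
  sInf {n : ℕ | ∃ l : List G, (∀ x ∈ l, x ∈ S ∨ x⁻¹ ∈ S) ∧ l.length = n ∧ l.prod = g}

/-- The word `g₁ g₂ ⋯ gₙ` of a one-sided sequence `g : ℕ → G` (indexed from `0`,
so `g i` represents `g_{i+1}`). -/
def wordN {G : Type*} [Group G] (g : ℕ → G) (n : ℕ) : G :=
  ((List.range n).map g).prod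

/-- `μ` is the one-sided Bernoulli product measure with marginal the weight
function `m`. -/
def IsBernoulliN {G : Type*} [MeasurableSpace G] (m : G → ℝ≥0∞)
    (μ : Measure (ℕ → G)) : Prop :=
  ∀ (s : Finset ℕ) (f : ℕ → G), μ {x | ∀ i ∈ s, x i = f i} = ∏ i ∈ s, m (f i)

/-- `n` is the first-entry time `τ` of the random walk `x` into `H`. -/
def FirstEntry {G : Type*} [Group G] (H : Subgroup G) (x : ℕ → G) (n : ℕ) : Prop :=
  1 ≤ n ∧ wordN x n ∈ H ∧ ∀ j : ℕ, 1 ≤ j → j < n → wordN x j ∉ H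

section WordN

variable {G : Type*} [Group G]

lemma wordN_zero (g : ℕ → G) : wordN g 0 = 1 := by simp [wordN]

lemma wordN_succ (g : ℕ → G) (n : ℕ) : wordN g (n + 1) = wordN g n * g n := by
  simp [wordN, List.range_succ]

lemma wordN_congr {g g' : ℕ → G} {n : ℕ} (h : ∀ i < n, g i = g' i) :
    wordN g n = wordN g' n := by
  induction n with
  | zero => simp [wordN_zero]
  | succ n ih =>
    rw [wordN_succ, wordN_succ, ih fun i hi => h i (by omega), h n (by omega)]

/-- The sequence that follows `x` for `k` steps and then starts reading `y`. -/
def seqConcat {α : Type*} (k : ℕ) (x y : ℕ → α) (i : ℕ) : α := if i < k then x i else y (i - k)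

lemma wordN_seqConcat_self (k : ℕ) (x y : ℕ → G) : wordN (seqConcat k x y) k = wordN x k :=
  wordN_congr fun i hi => by simp [seqConcat, hi]

lemma wordN_seqConcat_add (k n : ℕ) (x y : ℕ → G) :
    wordN (seqConcat k x y) (k + n) = wordN x k * wordN y n := by
  induction n with
  | zero => simp [wordN_seqConcat_self, wordN_zero]
  | succ n ih =>
    rw [← add_assoc, wordN_succ, wordN_succ, ih, mul_assoc]
    simp [seqConcat]

/-- The displacement of `g` along a homomorphism to `ℤ`. -/
def displacement (φ : G →* Multiplicative ℤ) (g : G) : ℤ := (φ g).toAdd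

lemma displacement_one (φ : G →* Multiplicative ℤ) : displacement φ 1 = 0 := by
  simp [displacement]

lemma displacement_mul (φ : G →* Multiplicative ℤ) (g h : G) :
    displacement φ (g * h) = displacement φ g + displacement φ h := by
  simp [displacement]

lemma displacement_inv (φ : G →* Multiplicative ℤ) (g : G) :
    displacement φ g⁻¹ = -displacement φ g := by
  simp [displacement]

lemma displacement_eq_zero_iff (φ : G →* Multiplicative ℤ) (g : G) :
    displacement φ g = 0 ↔ g ∈ φ.ker := by
  simp [displacement, MonoidHom.mem_ker]

lemma displacement_wordN_inv (φ : G →* Multiplicative ℤ) (x : ℕ → G) (k : ℕ) :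
    displacement φ (wordN (fun i => (x i)⁻¹) k) = -displacement φ (wordN x k) := by
  induction k with
  | zero => simp [wordN_zero, displacement_one]
  | succ k ih =>
    rw [wordN_succ, wordN_succ, displacement_mul, displacement_mul, ih, displacement_inv]
    ring

end WordN

section WordLength

variable {G : Type*} [Group G] {S : Finset G}

lemma exists_wordLength_eq (hS : Subgroup.closure (S : Set G) = ⊤) (g : G) :
    ∃ l : List G, (∀ x ∈ l, x ∈ S ∨ x⁻¹ ∈ S) ∧ l.length = wordLength S g ∧ l.prod = g := by
  have hg : g ∈ Subgroup.closure (S : Set G) := hS ▸ Subgroup.mem_top g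
  rw [← Subgroup.mem_toSubmonoid, Subgroup.closure_toSubmonoid] at hg
  obtain ⟨l, hl, hlg⟩ := Submonoid.exists_list_of_mem_closure hg
  exact Nat.sInf_mem (s := {n : ℕ | ∃ l : List G, (∀ x ∈ l, x ∈ S ∨ x⁻¹ ∈ S) ∧
    l.length = n ∧ l.prod = g}) ⟨l.length, l, fun x hx => by simpa using hl x hx, rfl, hlg⟩

lemma wordLength_one : wordLength S (1 : G) = 0 :=
  Nat.sInf_eq_zero.2 (Or.inl ⟨[], by simp⟩)

lemma wordLength_mul_le (hS : Subgroup.closure (S : Set G) = ⊤) (g h : G) :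
    wordLength S (g * h) ≤ wordLength S g + wordLength S h := by
  obtain ⟨l, hl, hlen, hprod⟩ := exists_wordLength_eq hS g
  obtain ⟨l', hl', hlen', hprod'⟩ := exists_wordLength_eq hS h
  refine Nat.sInf_le ⟨l ++ l', fun x hx => ?_, by simp [hlen, hlen'], by simp [hprod, hprod']⟩
  rcases List.mem_append.1 hx with hx | hx
  exacts [hl x hx, hl' x hx]

lemma wordLength_wordN_le (hS : Subgroup.closure (S : Set G) = ⊤) {D : ℕ} {x : ℕ → G}
    (hx : ∀ i, wordLength S (x i) ≤ D) (n : ℕ) : wordLength S (wordN x n) ≤ D * n := by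
  induction n with
  | zero => simp [wordN_zero, wordLength_one]
  | succ n ih =>
    rw [wordN_succ, mul_add, mul_one]
    exact (wordLength_mul_le hS _ _).trans (add_le_add ih (hx n))

end WordLength

section Bernoulli

variable {G : Type*} [MeasurableSpace G] {m : G → ℝ≥0∞} {μ ν : Measure (ℕ → G)}

lemma IsBernoulliN.unique [Countable G] [MeasurableSingletonClass G] [Nonempty G]
    [IsFiniteMeasure μ] (hμ : IsBernoulliN m μ) (hν : IsBernoulliN m ν) : μ = ν := by
  classical
  have key : ∀ ρ : Measure (ℕ → G), IsBernoulliN m ρ → ∀ (J : Finset ℕ) (f : J → G),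
      ρ.map J.restrict {f} =
        ∏ i ∈ J, m (if h : i ∈ J then f ⟨i, h⟩ else Classical.arbitrary G) := by
    intro ρ hρ J f
    rw [Measure.map_apply (by fun_prop) (measurableSet_singleton f), ← hρ J]
    congr 1
    ext x
    simp only [Set.mem_preimage, Set.mem_singleton_iff, Set.mem_ofPred_eq, funext_iff,
      Subtype.forall, Finset.restrict]
    exact forall₂_congr fun i hi => by simp [hi]
  have hlim : IsProjectiveLimit ν fun J : Finset ℕ => μ.map J.restrict := fun J =>
    Measure.ext_of_singleton fun f => by rw [key ν hν, key μ hμ]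
  exact IsProjectiveLimit.unique (P := fun J : Finset ℕ => μ.map J.restrict)
    (fun _ => rfl) hlim

lemma measurableSet_forall_mem_eq [MeasurableSingletonClass G] (s : Finset ℕ) (f : ℕ → G) :
    MeasurableSet {x : ℕ → G | ∀ i ∈ s, x i = f i} :=
  MeasurableSet.pi s.countable_toSet fun i _ => measurableSet_singleton (f i)

lemma IsBernoulliN.map_perm [Countable G] [DiscreteMeasurableSpace G] [Nonempty G]
    [IsFiniteMeasure μ] (hμ : IsBernoulliN m μ) (e : ℕ → Equiv.Perm G)
    (he : ∀ i g, m (e i g) = m g) : MeasurePreserving (fun x i => e i (x i)) μ μ := by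
  have hmeas : Measurable fun (x : ℕ → G) i => e i (x i) :=
    measurable_pi_lambda _ fun i => (Measurable.of_discrete (f := e i)).comp (measurable_pi_apply i)
  refine ⟨hmeas, (hμ.unique fun s f => ?_).symm⟩
  rw [Measure.map_apply hmeas (measurableSet_forall_mem_eq s f)]
  have h := hμ s fun i => (e i).symm (f i)
  rw [Finset.prod_congr rfl fun i _ => (he i ((e i).symm (f i))).symm] at h
  simp only [Equiv.apply_symm_apply] at h
  rw [← h]
  congr 1
  ext x
  simp [Equiv.eq_symm_apply]

lemma measurable_seqConcat (k : ℕ) :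
    Measurable fun p : (ℕ → G) × (ℕ → G) => seqConcat k p.1 p.2 := by
  refine measurable_pi_lambda _ fun i => ?_
  unfold seqConcat
  split_ifs <;> fun_prop

/-- The Bernoulli measure is preserved by splicing two independent sequences. -/
lemma IsBernoulliN.map_seqConcat [Countable G] [DiscreteMeasurableSpace G] [Nonempty G]
    [IsProbabilityMeasure μ] (hμ : IsBernoulliN m μ) (k : ℕ) :
    MeasurePreserving (fun p : (ℕ → G) × (ℕ → G) => seqConcat k p.1 p.2) (μ.prod μ) μ := by
  refine ⟨measurable_seqConcat k, (hμ.unique fun s f => ?_).symm⟩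
  rw [Measure.map_apply (measurable_seqConcat k) (measurableSet_forall_mem_eq s f)]
  have hpre : (fun p : (ℕ → G) × (ℕ → G) => seqConcat k p.1 p.2) ⁻¹' {x | ∀ i ∈ s, x i = f i} =
      {x | ∀ i ∈ s.filter (· < k), x i = f i} ×ˢ
        {y | ∀ j ∈ (s.filter fun i => ¬ i < k).image (· - k), y j = f (j + k)} := by
    ext ⟨x, y⟩
    simp only [Set.mem_preimage, Set.mem_ofPred_eq, Set.mem_prod, Finset.mem_filter,
      Finset.mem_image, seqConcat]
    constructor
    · refine fun h => ⟨fun i hi => ?_, ?_⟩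
      · simpa [hi.2] using h i hi.1
      · rintro _ ⟨i, ⟨his, hik⟩, rfl⟩
        simpa [hik, Nat.sub_add_cancel (not_lt.1 hik)] using h i his
    · rintro ⟨h₁, h₂⟩ i hi
      split_ifs with hik
      · exact h₁ i ⟨hi, hik⟩
      · simpa [Nat.sub_add_cancel (not_lt.1 hik)] using h₂ (i - k) ⟨i, ⟨hi, hik⟩, rfl⟩
  rw [hpre, Measure.prod_prod, hμ, hμ _ fun j => f (j + k), Finset.prod_image,
    ← Finset.prod_filter_mul_prod_filter_not s (· < k)]
  · congr 1
    refine Finset.prod_congr rfl fun i hi => ?_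
    rw [Nat.sub_add_cancel (not_lt.1 (Finset.mem_filter.1 hi).2)]
  · intro i hi j hj hij
    have hi' := (Finset.mem_filter.1 hi).2
    have hj' := (Finset.mem_filter.1 hj).2
    simp only at hij
    omega

lemma IsBernoulliN.ae_ne_zero [Countable G] (hμ : IsBernoulliN m μ) :
    ∀ᵐ x ∂μ, ∀ i, m (x i) ≠ 0 := by
  refine ae_all_iff.2 fun i => ?_
  have h : ∀ᵐ x ∂μ, ∀ g : G, m g = 0 → x i ≠ g := by
    refine ae_all_iff.2 fun g => ?_
    by_cases hg : m g = 0
    · have := hμ {i} fun _ => g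
      simp only [Finset.mem_singleton, forall_eq, Finset.prod_singleton, hg] at this
      filter_upwards [measure_eq_zero_iff_ae_notMem.1 this] with x hx _ using hx
    · simp [hg]
  filter_upwards [h] with x hx h0 using hx _ h0 rfl

end Bernoulli

section RandomWalk

variable {G : Type*} [Group G] [Countable G] [MeasurableSpace G] [DiscreteMeasurableSpace G]
  {m : G → ℝ≥0∞} {μ : Measure (ℕ → G)}

lemma measurable_wordN (n : ℕ) : Measurable fun x : ℕ → G => wordN x n := by
  induction n with
  | zero => simp only [wordN_zero, measurable_const]
  | succ n ih =>
    simp only [wordN_succ]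
    exact ih.mul (measurable_pi_apply n)

lemma measurableSet_wordN (n : ℕ) (p : G → Prop) : MeasurableSet {x : ℕ → G | p (wordN x n)} :=
  measurable_wordN n (MeasurableSet.of_discrete (s := {g | p g}))

/-- The event that the walk avoids `H` at all times `1, …, n`. -/
def avoids (H : Subgroup G) (n : ℕ) : Set (ℕ → G) :=
  {x | ∀ j, 1 ≤ j → j ≤ n → wordN x j ∉ H}

/-- Decomposing at the last visit to `H` before time `n`. -/
lemma IsBernoulliN.sum_mul_avoids_le_one [IsProbabilityMeasure μ] (hμ : IsBernoulliN m μ)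
    (H : Subgroup G) (n : ℕ) :
    (∑ k ∈ Finset.range (n + 1), μ {x | wordN x k ∈ H}) * μ (avoids H n) ≤ 1 := by
  let E : ℕ → Set (ℕ → G) := fun k =>
    {x | wordN x k ∈ H ∧ ∀ j, k < j → j ≤ n → wordN x j ∉ H}
  have hE : ∀ k, MeasurableSet (E k) := fun k => by
    refine (measurableSet_wordN k (· ∈ H)).inter ?_
    change MeasurableSet {x : ℕ → G | ∀ j, k < j → j ≤ n → wordN x j ∉ H}
    simp only [Set.ofPred_forall]
    exact .iInter fun j => .iInter fun _ => .iInter fun _ => measurableSet_wordN j (· ∉ H)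
  have hdisj : Set.PairwiseDisjoint (Finset.range (n + 1) : Set ℕ) E := by
    have key : ∀ i j, j ≤ n → i < j → Disjoint (E i) (E j) := fun i j hj hij =>
      Set.disjoint_left.2 fun x hxi hxj => hxi.2 j hij hj hxj.1
    intro i hi j hj hij
    simp only [Finset.coe_range, Set.mem_Iio] at hi hj
    rcases lt_or_gt_of_ne hij with h | h
    exacts [key i j (by omega) h, (key j i (by omega) h).symm]
  calc (∑ k ∈ Finset.range (n + 1), μ {x | wordN x k ∈ H}) * μ (avoids H n)
      = ∑ k ∈ Finset.range (n + 1), μ {x | wordN x k ∈ H} * μ (avoids H n) :=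
        Finset.sum_mul ..
    _ ≤ ∑ k ∈ Finset.range (n + 1), μ (E k) := by
        refine Finset.sum_le_sum fun k _ => ?_
        rw [← Measure.prod_prod, ← (hμ.map_seqConcat k).measure_preimage (hE k).nullMeasurableSet]
        refine measure_mono ?_
        rintro ⟨x, y⟩ ⟨hx, hy⟩
        refine ⟨by simpa [wordN_seqConcat_self] using hx, fun j hkj hjn => ?_⟩
        obtain ⟨i, rfl⟩ := Nat.exists_eq_add_of_lt hkj
        rw [add_assoc, wordN_seqConcat_add, H.mul_mem_cancel_left hx]
        exact hy _ (by omega) (by omega)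
    _ = μ (⋃ k ∈ Finset.range (n + 1), E k) :=
        (measure_biUnion_finset hdisj fun k _ => hE k).symm
    _ ≤ 1 := prob_le_one

/-- For a symmetric walk, the second moment of the displacement grows at most linearly. -/
lemma IsBernoulliN.lintegral_displacement_sq_le [IsProbabilityMeasure μ]
    (hμ : IsBernoulliN m μ) (hsym : ∀ g, m g = m g⁻¹) (φ : G →* Multiplicative ℤ) {M : ℕ}
    (hM : ∀ g, m g ≠ 0 → (displacement φ g).natAbs ≤ M) (k : ℕ) :
    ∫⁻ x, ((displacement φ (wordN x k)).natAbs : ℝ≥0∞) ^ 2 ∂μ ≤ k * M ^ 2 := by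
  have hmeas : ∀ k, Measurable fun x : ℕ → G =>
      ((displacement φ (wordN x k)).natAbs : ℝ≥0∞) ^ 2 := fun k =>
    (Measurable.of_discrete (f := fun g : G => ((displacement φ g).natAbs : ℝ≥0∞) ^ 2)).comp
      (measurable_wordN k)
  induction k with
  | zero => simp [wordN_zero, displacement_one]
  | succ k ih =>
    classical
    set V := ∫⁻ x, ((displacement φ (wordN x (k + 1))).natAbs : ℝ≥0∞) ^ 2 ∂μ with hV
    let e : ℕ → Equiv.Perm G := fun i => if i = k then Equiv.inv G else Equiv.refl G
    have hflip : MeasurePreserving (fun x i => e i (x i)) μ μ := hμ.map_perm e fun i g => by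
      by_cases h : i = k <;> simp [e, h, ← hsym]
    have hword : ∀ x : ℕ → G, displacement φ (wordN (fun i => e i (x i)) (k + 1)) =
        displacement φ (wordN x k) - displacement φ (x k) := fun x => by
      rw [wordN_succ, displacement_mul,
        wordN_congr (g' := x) fun i hi => by simp [e, hi.ne]]
      simp [e, displacement_inv, sub_eq_add_neg]
    have hV' : V = ∫⁻ x, ((displacement φ (wordN x k) - displacement φ (x k)).natAbs : ℝ≥0∞) ^ 2
        ∂μ := by
      rw [hV, ← hflip.lintegral_comp (hmeas (k + 1))]
      simp only [hword]
    have hpar : V + V ≤ 2 * (k * M ^ 2 + M ^ 2) := by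
      calc V + V = ∫⁻ x, (((displacement φ (wordN x (k + 1))).natAbs : ℝ≥0∞) ^ 2 +
              ((displacement φ (wordN x k) - displacement φ (x k)).natAbs : ℝ≥0∞) ^ 2) ∂μ := by
            rw [lintegral_add_left (hmeas (k + 1)), ← hV', ← hV]
        _ ≤ ∫⁻ x, 2 * (((displacement φ (wordN x k)).natAbs : ℝ≥0∞) ^ 2 + M ^ 2) ∂μ := by
            refine lintegral_mono_ae ?_
            filter_upwards [hμ.ae_ne_zero] with x hx
            have h1 := hM _ (hx k)
            rw [wordN_succ, displacement_mul]
            norm_cast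
            generalize displacement φ (wordN x k) = a at *
            generalize displacement φ (x k) = b at *
            have h2 : b.natAbs ^ 2 ≤ M ^ 2 := Nat.pow_le_pow_left h1 2
            zify at h2 ⊢
            simp only [sq_abs] at h2 ⊢
            nlinarith
        _ = 2 * (∫⁻ x, ((displacement φ (wordN x k)).natAbs : ℝ≥0∞) ^ 2 ∂μ + M ^ 2) := by
            rw [lintegral_const_mul _ ((hmeas k).add_const _), lintegral_add_left (hmeas k)]
            simp
        _ ≤ _ := by gcongr
    rw [← two_mul] at hpar
    have := (ENNReal.mul_le_mul_iff_right two_ne_zero ENNReal.ofNat_ne_top).1 hpar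
    refine this.trans (le_of_eq ?_)
    push_cast
    ring

/-- Lower bound on the return probability of a symmetric walk at even times. -/
lemma IsBernoulliN.return_probability_ge [IsProbabilityMeasure μ]
    (hμ : IsBernoulliN m μ) (hsym : ∀ g, m g = m g⁻¹) (φ : G →* Multiplicative ℤ) {M : ℕ}
    (hM1 : 1 ≤ M) (hM : ∀ g, m g ≠ 0 → (displacement φ g).natAbs ≤ M) {k N : ℕ} (hN1 : 1 ≤ N)
    (hk : k ≤ N ^ 2) :
    1 ≤ 10 * (M * N : ℝ) * μ.real {x | wordN x (k + k) ∈ φ.ker} := by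
  let L : ℕ := 2 * M * N
  let A : ℤ → Set (ℕ → G) := fun z => {x | displacement φ (wordN x k) = z}
  have hA : ∀ z, MeasurableSet (A z) := fun z =>
    measurableSet_wordN k (displacement φ · = z)
  have hAneg : ∀ z, μ (A (-z)) = μ (A z) := fun z => by
    have hinv : MeasurePreserving (fun (x : ℕ → G) i => (x i)⁻¹) μ μ :=
      hμ.map_perm (fun _ => Equiv.inv G) fun _ g => (hsym g).symm
    rw [← hinv.measure_preimage (hA z).nullMeasurableSet]
    congr 1
    ext x
    simp [A, displacement_wordN_inv, neg_eq_iff_eq_neg]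
  have hAdisj : ∀ i j, i ≠ j → Disjoint (A i) (A j) := fun i j hij =>
    Set.disjoint_left.2 fun x hi hj => hij (hi.symm.trans hj)
  let I : Finset ℤ := Finset.Icc (-(L : ℤ)) L
  have hreturn : ∑ z ∈ I, μ.real (A z) ^ 2 ≤ μ.real {x | wordN x (k + k) ∈ φ.ker} := by
    have hR := measurableSet_wordN (G := G) (k + k) (· ∈ φ.ker)
    calc ∑ z ∈ I, μ.real (A z) ^ 2
        = ∑ z ∈ I, (μ.prod μ).real (A z ×ˢ A (-z)) := by
          refine Finset.sum_congr rfl fun z _ => ?_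
          rw [measureReal_prod_prod, sq, measureReal_def μ (A (-z)), hAneg, measureReal_def]
      _ = (μ.prod μ).real (⋃ z ∈ I, A z ×ˢ A (-z)) := by
          refine (measureReal_biUnion_finset (fun i _ j _ hij => ?_)
            fun z _ => (hA z).prod (hA (-z))).symm
          exact Set.Disjoint.set_prod_left (hAdisj i j hij) _ _
      _ ≤ μ.real {x | wordN x (k + k) ∈ φ.ker} := by
          rw [← (hμ.map_seqConcat k).measureReal_preimage hR.nullMeasurableSet]
          refine measureReal_mono ?_
          rintro ⟨x, y⟩ hxy
          simp only [Set.mem_iUnion] at hxy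
          obtain ⟨z, _, hx, hy⟩ := hxy
          have hx : displacement φ (wordN x k) = z := hx
          have hy : displacement φ (wordN y k) = -z := hy
          simp only [Set.mem_preimage, Set.mem_ofPred_eq]
          rw [wordN_seqConcat_add, ← displacement_eq_zero_iff, displacement_mul, hx, hy]
          ring
  have hmass : (3 / 4 : ℝ) ≤ ∑ z ∈ I, μ.real (A z) := by
    have hfar : μ.real {x | L ≤ (displacement φ (wordN x k)).natAbs} ≤ 1 / 4 := by
      have h1 := mul_meas_ge_le_lintegral (μ := μ)
        ((Measurable.of_discrete (f := fun g : G => ((displacement φ g).natAbs : ℝ≥0∞) ^ 2)).comp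
          (measurable_wordN k)) ((L : ℝ≥0∞) ^ 2)
      have h2 := h1.trans (hμ.lintegral_displacement_sq_le hsym φ hM k)
      have h3 : {x : ℕ → G | L ≤ (displacement φ (wordN x k)).natAbs} ⊆
          {x | (L : ℝ≥0∞) ^ 2 ≤ ((fun g : G => ((displacement φ g).natAbs : ℝ≥0∞) ^ 2) ∘
            fun x => wordN x k) x} := fun x hx => by
        have hx : L ≤ (displacement φ (wordN x k)).natAbs := hx
        simp only [Set.mem_ofPred_eq, Function.comp]
        gcongr
      have h4 := (mul_le_mul_right (measure_mono (μ := μ) h3) ((L : ℝ≥0∞) ^ 2)).trans h2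
      have h5 := ENNReal.toReal_mono (by finiteness) h4
      simp only [ENNReal.toReal_mul, ENNReal.toReal_pow, ENNReal.toReal_natCast] at h5
      rw [← measureReal_def] at h5
      have hkN : (k : ℝ) ≤ (N : ℝ) ^ 2 := by exact_mod_cast hk
      have hpos : (0 : ℝ) < (M * N) ^ 2 := by positivity
      have h6 : (M * N : ℝ) ^ 2 * (4 * μ.real {x | L ≤ (displacement φ (wordN x k)).natAbs}) ≤
          (M * N) ^ 2 * 1 := by
        have : (k : ℝ) * M ^ 2 ≤ N ^ 2 * M ^ 2 := by gcongr
        simp only [L, Nat.cast_mul, Nat.cast_ofNat] at h5 ⊢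
        linarith
      linarith [le_of_mul_le_mul_left h6 hpos]
    have hunion : μ.real (⋃ z ∈ I, A z) = ∑ z ∈ I, μ.real (A z) :=
      measureReal_biUnion_finset (fun i _ j _ hij => hAdisj i j hij) fun z _ => hA z
    have hcover : (Set.univ : Set (ℕ → G)) ⊆
        (⋃ z ∈ I, A z) ∪ {x | L ≤ (displacement φ (wordN x k)).natAbs} := by
      intro x _
      by_cases hx : L ≤ (displacement φ (wordN x k)).natAbs
      · exact Or.inr hx
      · refine Or.inl (Set.mem_biUnion (x := displacement φ (wordN x k)) ?_ rfl)
        simp only [I, Finset.mem_coe, Finset.mem_Icc]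
        omega
    have h1 := (measureReal_mono (μ := μ) hcover).trans (measureReal_union_le _ _)
    rw [hunion, probReal_univ] at h1
    linarith
  have hcs := sq_sum_le_card_mul_sum_sq (s := I) (f := fun z => μ.real (A z))
  have hcard : (I.card : ℝ) ≤ 5 * (M * N) := by
    have h1 : I.card = 2 * L + 1 := by
      simp only [I, Int.card_Icc]
      omega
    have h2 : 1 ≤ M * N := Nat.mul_pos hM1 hN1
    have h3 : I.card ≤ 5 * (M * N) := by
      rw [h1]
      simp only [L, mul_assoc]
      omega
    exact_mod_cast h3
  have hsq : (3 / 4 : ℝ) ^ 2 ≤ (∑ z ∈ I, μ.real (A z)) ^ 2 := by gcongr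
  have hbound : (I.card : ℝ) * ∑ z ∈ I, μ.real (A z) ^ 2 ≤
      5 * (M * N) * μ.real {x | wordN x (k + k) ∈ φ.ker} := by gcongr
  linarith

/-- The first-return time to the kernel has tail `O(n ^ (-1/2))`. -/
lemma IsBernoulliN.avoids_ker_le [IsProbabilityMeasure μ]
    (hμ : IsBernoulliN m μ) (hsym : ∀ g, m g = m g⁻¹) (φ : G →* Multiplicative ℤ) {M : ℕ}
    (hM1 : 1 ≤ M) (hM : ∀ g, m g ≠ 0 → (displacement φ g).natAbs ≤ M) (n : ℕ) :
    μ.real (avoids φ.ker n) ≤ 30 * M * ((n : ℝ) + 1) ^ (-(1 / 2) : ℝ) := by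
  have hsqrt : ((n : ℝ) + 1) ^ (-(1 / 2) : ℝ) = (√((n : ℝ) + 1))⁻¹ := by
    rw [Real.rpow_neg (by positivity), Real.sqrt_eq_rpow]
  have hM1' : (1 : ℝ) ≤ M := by exact_mod_cast hM1
  rw [hsqrt, ← div_eq_mul_inv, le_div_iff₀ (by positivity)]
  rcases lt_or_ge n 2 with hn | hn
  · have h1 : μ.real (avoids φ.ker n) ≤ 1 := measureReal_le_one
    have h2 : √((n : ℝ) + 1) ≤ 3 := by
      rw [Real.sqrt_le_left (by norm_num)]
      have : (n : ℝ) < 2 := by exact_mod_cast hn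
      linarith
    calc _ ≤ 1 * (3 : ℝ) := by gcongr
      _ ≤ _ := by linarith
  · set N := Nat.sqrt (n / 2) with hN
    have hN1 : 1 ≤ N := Nat.sqrt_pos.2 (by omega)
    have hNn : N ^ 2 ≤ n / 2 := Nat.sqrt_le' _
    have hnN : n / 2 < (N + 1) ^ 2 := Nat.lt_succ_sqrt' _
    have hN1' : (1 : ℝ) ≤ N := by exact_mod_cast hN1
    have h2 : √((n : ℝ) + 1) ≤ 3 * N := by
      rw [Real.sqrt_le_left (by positivity)]
      have h3 : n + 1 ≤ 2 * (N + 1) ^ 2 := by omega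
      have h4 : (n : ℝ) + 1 ≤ 2 * (N + 1) ^ 2 := by exact_mod_cast h3
      nlinarith
    have hsum : (N : ℝ) ^ 2 ≤
        10 * (M * N : ℝ) * ∑ j ∈ Finset.range (n + 1), μ.real {x | wordN x j ∈ φ.ker} := by
      calc (N : ℝ) ^ 2 ≤ ∑ k ∈ Finset.range (N ^ 2 + 1), (1 : ℝ) := by simp
        _ ≤ ∑ k ∈ Finset.range (N ^ 2 + 1),
              10 * (M * N : ℝ) * μ.real {x | wordN x (k + k) ∈ φ.ker} :=
            Finset.sum_le_sum fun k hk => hμ.return_probability_ge hsym φ hM1 hM hN1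
              (Nat.lt_succ_iff.1 (Finset.mem_range.1 hk))
        _ = 10 * (M * N : ℝ) * ∑ j ∈ (Finset.range (N ^ 2 + 1)).image (fun k => k + k),
              μ.real {x | wordN x j ∈ φ.ker} := by
            rw [← Finset.mul_sum, Finset.sum_image fun a _ b _ (h : a + a = b + b) => by omega]
        _ ≤ _ := by
            gcongr
            intro j hj
            simp only [Finset.mem_image, Finset.mem_range] at hj ⊢
            omega
    have hlast := ENNReal.toReal_mono ENNReal.one_ne_top (hμ.sum_mul_avoids_le_one φ.ker n)
    rw [ENNReal.toReal_mul, ENNReal.toReal_sum fun _ _ => measure_ne_top _ _,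
      ENNReal.toReal_one] at hlast
    simp only [← measureReal_def] at hlast
    set T := μ.real (avoids φ.ker n)
    have hT : 0 ≤ T := measureReal_nonneg
    have h5 : (N : ℝ) * (N * T) ≤ N * (10 * M) := by
      calc (N : ℝ) * (N * T) = N ^ 2 * T := by ring
        _ ≤ 10 * (M * N : ℝ) *
            (∑ j ∈ Finset.range (n + 1), μ.real {x | wordN x j ∈ φ.ker}) * T := by gcongr
        _ ≤ 10 * (M * N : ℝ) * 1 := by
            rw [mul_assoc]
            gcongr
        _ = _ := by ring
    have h6 := le_of_mul_le_mul_left h5 (by linarith)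
    calc T * √((n : ℝ) + 1) ≤ T * (3 * N) := by gcongr
      _ ≤ _ := by linarith

end RandomWalk

section Moments

/-- `n ^ p` is dominated by the sum of the first `n` terms `k ^ (p - 1)` when `p ≤ 1`. -/
lemma rpow_le_sum_range_rpow_sub_one {p : ℝ} (hp : p ≤ 1) {n : ℕ} (hn : 1 ≤ n) :
    (n : ℝ) ^ p ≤ ∑ k ∈ Finset.range n, ((k : ℝ) + 1) ^ (p - 1) := by
  have hn0 : (0 : ℝ) < n := by exact_mod_cast hn
  calc (n : ℝ) ^ p = ∑ k ∈ Finset.range n, (n : ℝ) ^ (p - 1) := by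
        rw [Finset.sum_const, Finset.card_range, nsmul_eq_mul, Real.rpow_sub_one hn0.ne']
        field_simp
    _ ≤ _ := by
        refine Finset.sum_le_sum fun k hk => ?_
        refine Real.rpow_le_rpow_of_nonpos (by positivity) ?_ (by linarith)
        exact_mod_cast Finset.mem_range.1 hk

/-- A sequence of weights with tails `O(n ^ (-1/2))` has finite `p`-th moment for `p < 1/2`. -/
lemma tsum_rpow_mul_lt_top {w T : ℕ → ℝ≥0∞} {C p : ℝ} (hp : p < 1 / 2)
    (hw : w 0 = 0) (hwT : ∀ k, ∑' n, (if k < n then w n else 0) ≤ T k)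
    (hT : ∀ k : ℕ, T k ≤ ENNReal.ofReal (C * ((k : ℝ) + 1) ^ (-(1 / 2) : ℝ))) :
    ∑' n : ℕ, ENNReal.ofReal ((n : ℝ) ^ p) * w n < ⊤ := by
  have hterm : ∀ n : ℕ, ENNReal.ofReal ((n : ℝ) ^ p) * w n ≤
      ∑' k : ℕ, ENNReal.ofReal (((k : ℝ) + 1) ^ (p - 1)) * (if k < n then w n else 0) := by
    intro n
    rcases Nat.eq_zero_or_pos n with rfl | hn
    · simp [hw]
    calc ENNReal.ofReal ((n : ℝ) ^ p) * w n
        ≤ ENNReal.ofReal (∑ k ∈ Finset.range n, ((k : ℝ) + 1) ^ (p - 1)) * w n := by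
          gcongr
          exact rpow_le_sum_range_rpow_sub_one (by linarith) hn
      _ = ∑ k ∈ Finset.range n,
            ENNReal.ofReal (((k : ℝ) + 1) ^ (p - 1)) * (if k < n then w n else 0) := by
          rw [ENNReal.ofReal_sum_of_nonneg fun _ _ => by positivity, Finset.sum_mul]
          exact Finset.sum_congr rfl fun k hk => by rw [if_pos (Finset.mem_range.1 hk)]
      _ ≤ _ := ENNReal.sum_le_tsum _
  have hsummable : Summable fun k : ℕ => C * ((k : ℝ) + 1) ^ (p - 3 / 2) := by
    have h := (summable_nat_add_iff 1).2 (Real.summable_nat_rpow (p := p - 3 / 2) |>.2 (by linarith))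
    exact (by simpa using h : Summable fun k : ℕ => ((k : ℝ) + 1) ^ (p - 3 / 2)).mul_left C
  calc ∑' n : ℕ, ENNReal.ofReal ((n : ℝ) ^ p) * w n
      ≤ ∑' (n : ℕ) (k : ℕ), ENNReal.ofReal (((k : ℝ) + 1) ^ (p - 1)) *
          (if k < n then w n else 0) := ENNReal.tsum_le_tsum hterm
    _ = ∑' k : ℕ, ENNReal.ofReal (((k : ℝ) + 1) ^ (p - 1)) *
          ∑' n : ℕ, (if k < n then w n else 0) := by
        rw [ENNReal.tsum_comm]
        simp only [ENNReal.tsum_mul_left]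
    _ ≤ ∑' k : ℕ, ENNReal.ofReal (C * ((k : ℝ) + 1) ^ (p - 3 / 2)) := by
        refine ENNReal.tsum_le_tsum fun k => ?_
        calc _ ≤ ENNReal.ofReal (((k : ℝ) + 1) ^ (p - 1)) *
              ENNReal.ofReal (C * ((k : ℝ) + 1) ^ (-(1 / 2) : ℝ)) := by
              gcongr
              exact (hwT k).trans (hT k)
          _ = _ := by
              rw [← ENNReal.ofReal_mul (by positivity), mul_left_comm,
                ← Real.rpow_add (by positivity)]
              ring_nf
    _ < ⊤ := hsummable.tsum_ofReal_lt_top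

end Moments

section FirstReturn

variable {G : Type*} [Group G]

lemma FirstEntry.unique {H : Subgroup G} {x : ℕ → G} {n k : ℕ} (hn : FirstEntry H x n)
    (hk : FirstEntry H x k) : n = k := by
  by_contra h
  rcases lt_or_gt_of_ne h with h | h
  exacts [hk.2.2 n hn.1 h hn.2.1, hn.2.2 k hk.1 h hk.2.1]

variable [Countable G] [MeasurableSpace G] [DiscreteMeasurableSpace G]

lemma measurableSet_firstEntry (H : Subgroup G) (n : ℕ) :
    MeasurableSet {x : ℕ → G | FirstEntry H x n} := by
  refine (MeasurableSet.const (1 ≤ n)).inter ((measurableSet_wordN n (· ∈ H)).inter ?_)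
  change MeasurableSet {x : ℕ → G | ∀ j, 1 ≤ j → j < n → wordN x j ∉ H}
  simp only [Set.ofPred_forall]
  exact .iInter fun j => .iInter fun _ => .iInter fun _ => measurableSet_wordN j (· ∉ H)

lemma tsum_firstEntry_le_avoids (μ : Measure (ℕ → G)) (H : Subgroup G) (k : ℕ) :
    ∑' n, (if k < n then μ {x | FirstEntry H x n} else 0) ≤ μ (avoids H k) := by
  let F : ℕ → Set (ℕ → G) := fun n => {x | k < n ∧ FirstEntry H x n}
  have hF : ∀ n, (if k < n then μ {x | FirstEntry H x n} else 0) = μ (F n) := fun n => by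
    by_cases h : k < n <;> simp [F, h]
  simp only [hF]
  rw [← measure_iUnion]
  · refine measure_mono (Set.iUnion_subset ?_)
    rintro n x ⟨hkn, hx⟩ j hj hjk
    exact hx.2.2 j hj (by omega)
  · exact fun i j hij => Set.disjoint_left.2 fun x hi hj => hij (hi.2.unique hj.2)
  · exact fun n => (MeasurableSet.const (k < n)).inter (measurableSet_firstEntry H n)

/-- If the word length of the walk at time `n` is at most `D * n`, the moments of the first-return
distribution are controlled by those of the first-return time. -/
lemma tsum_wordLength_rpow_mul_le {μ : Measure (ℕ → G)} {S : Finset G} {D : ℕ}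
    (hD : ∀ᵐ x ∂μ, ∀ n, wordLength S (wordN x n) ≤ D * n) (H : Subgroup G) {p : ℝ} (hp : 0 ≤ p) :
    ∑' h : G, (wordLength S h : ℝ≥0∞) ^ p * μ {x | ∃ n, FirstEntry H x n ∧ wordN x n = h} ≤
      (D : ℝ≥0∞) ^ p * ∑' n : ℕ, ENNReal.ofReal ((n : ℝ) ^ p) * μ {x | FirstEntry H x n} := by
  let E : ℕ → G → Set (ℕ → G) := fun n h => {x | FirstEntry H x n ∧ wordN x n = h}
  have hlength : ∀ n h, (wordLength S h : ℝ≥0∞) ^ p * μ (E n h) ≤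
      (D : ℝ≥0∞) ^ p * (ENNReal.ofReal ((n : ℝ) ^ p) * μ (E n h)) := by
    intro n h
    by_cases h0 : μ (E n h) = 0
    · simp [h0]
    obtain ⟨x, hx, hxD⟩ := Filter.Frequently.exists
      ((frequently_ae_mem_iff.2 h0).and_eventually hD)
    have hle : wordLength S h ≤ D * n := hx.2 ▸ hxD n
    rw [← ENNReal.ofReal_rpow_of_nonneg (by positivity) hp, ENNReal.ofReal_natCast, ← mul_assoc,
      ← ENNReal.mul_rpow_of_nonneg _ _ hp]
    gcongr
    exact_mod_cast hle
  have hsum : ∀ n, ∑' h, μ (E n h) ≤ μ {x | FirstEntry H x n} := fun n => by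
    rw [← measure_iUnion]
    · exact measure_mono (Set.iUnion_subset fun h x hx => hx.1)
    · exact fun i j hij => Set.disjoint_left.2 fun x hi hj => hij (hi.2.symm.trans hj.2)
    · exact fun h => (measurableSet_firstEntry H n).inter (measurableSet_wordN n (· = h))
  calc ∑' h : G, (wordLength S h : ℝ≥0∞) ^ p * μ {x | ∃ n, FirstEntry H x n ∧ wordN x n = h}
      ≤ ∑' h : G, ∑' n : ℕ, (D : ℝ≥0∞) ^ p * (ENNReal.ofReal ((n : ℝ) ^ p) * μ (E n h)) := by
        refine ENNReal.tsum_le_tsum fun h => ?_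
        calc _ ≤ (wordLength S h : ℝ≥0∞) ^ p * ∑' n, μ (E n h) := by
              gcongr
              rw [Set.ofPred_exists]
              exact measure_iUnion_le _
          _ ≤ _ := by
              rw [← ENNReal.tsum_mul_left]
              exact ENNReal.tsum_le_tsum fun n => hlength n h
    _ = (D : ℝ≥0∞) ^ p * ∑' n : ℕ, ENNReal.ofReal ((n : ℝ) ^ p) * ∑' h : G, μ (E n h) := by
        rw [ENNReal.tsum_comm]
        simp only [ENNReal.tsum_mul_left]
    _ ≤ _ := by
        gcongr with n
        exact hsum n

end FirstReturn

/-- **The first-return distribution `m' = ξ_* m^ℕ` of a symmetric, finitely supported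
random walk on a normal subgroup `H` with `G/H ≅ ℤ` has finite `p`-th moment for all
`0 ≤ p < 1/2`.** Here `m' h = μN {x | ξ x = h}`. -/
theorem firstReturn_finite_pth_moment {G : Type*} [Group G] [Countable G]
    [MeasurableSpace G] [DiscreteMeasurableSpace G]
    (H : Subgroup G) [H.Normal]
    (hquot : Nonempty ((G ⧸ H) ≃* Multiplicative ℤ))
    (S : Finset G) (hS : Subgroup.closure (S : Set G) = ⊤)
    (m : G → ℝ≥0∞) (hm : ∑' g : G, m g = 1)
    (hsym : ∀ g : G, m g = m g⁻¹)
    (hfinsupp : {g : G | m g ≠ 0}.Finite)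
    (hgen : Subgroup.closure {g : G | m g ≠ 0} = ⊤)
    (μN : Measure (ℕ → G)) [IsProbabilityMeasure μN] (hBern : IsBernoulliN m μN)
    (hτ : ∀ᵐ x ∂μN, ∃ n : ℕ, FirstEntry H x n)
    (p : ℝ) (hp0 : 0 ≤ p) (hp : p < 1 / 2) :
    ∑' h : G, (wordLength S h : ℝ≥0∞) ^ p *
      μN {x : ℕ → G | ∃ n : ℕ, FirstEntry H x n ∧ wordN x n = h} < ⊤ := by
  obtain ⟨e⟩ := hquot
  let φ : G →* Multiplicative ℤ := e.toMonoidHom.comp (QuotientGroup.mk' H)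
  have hker : φ.ker = H := by
    ext g
    simp [φ]
  obtain ⟨M, hM⟩ := (hfinsupp.image fun g => (displacement φ g).natAbs).bddAbove
  obtain ⟨D, hD⟩ := (hfinsupp.image (wordLength S)).bddAbove
  have hM' : ∀ g, m g ≠ 0 → (displacement φ g).natAbs ≤ max M 1 := fun g hg =>
    (hM (Set.mem_image_of_mem _ hg)).trans (le_max_left _ _)
  have hlength : ∀ᵐ x ∂μN, ∀ n, wordLength S (wordN x n) ≤ D * n := by
    filter_upwards [hBern.ae_ne_zero] with x hx n
    exact wordLength_wordN_le hS (fun i => hD (Set.mem_image_of_mem _ (hx i))) n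
  refine (tsum_wordLength_rpow_mul_le hlength H hp0).trans_lt (ENNReal.mul_lt_top
    (by finiteness) (tsum_rpow_mul_lt_top hp ?_ (tsum_firstEntry_le_avoids μN H)
      (C := 30 * (max M 1 : ℕ)) fun k => ?_))
  · simp [FirstEntry]
  · rw [← ofReal_measureReal, ← hker]
    exact ENNReal.ofReal_le_ofReal
      (hBern.avoids_ker_le hsym φ (le_max_right _ _) hM' k)
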